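/- Fix m ∈ {2,…,n−2} and δ ∈ ℂ \ {0}. The algebraic multiplicity of the eigenvalue 0 of S^m + δJ equals n − ⌊(n−1)/m⌋ − 1, and since m − 1 < n − ⌊(n−1)/m⌋ − 1 for 2 ≤ m ≤ n−2, the matrix S^m + δJ is not diagonalizable. -/

import Mathlib

open Polynomial

def shiftMatrix (n : ℕ) : Matrix (Fin n) (Fin n) ℂ :=
  Matrix.of fun j k => if (j : ℕ) + 1 = (k : ℕ) then 1 else 0

def allOnes (n : ℕ) : Matrix (Fin n) (Fin n) ℂ := Matrix.of fun _ _ => 1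

theorem shift_pow_apply (n k : ℕ) (i j : Fin n) :
    (shiftMatrix n ^ k) i j = if (i : ℕ) + k = (j : ℕ) then 1 else 0 := by
  induction k generalizing i with
  | zero => simp [Matrix.one_apply, Fin.ext_iff]
  | succ k ih =>
    rw [pow_succ', Matrix.mul_apply]
    simp only [ih]
    have hS : ∀ a b : Fin n, shiftMatrix n a b = if (a : ℕ) + 1 = (b : ℕ) then 1 else 0 :=
      fun _ _ => rfl
    simp only [hS]
    by_cases h : (i : ℕ) + 1 < n
    · rw [Finset.sum_eq_single (⟨i + 1, h⟩ : Fin n)]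
      · simp [add_assoc, add_comm 1 k]
      · intro b _ hb
        have : ¬ ((i : ℕ) + 1 = b) := fun e => hb (Fin.ext e.symm)
        simp [this]
      · simp
    · rw [Finset.sum_eq_zero]
      · have := j.2
        rw [if_neg (by omega)]
      · intro b _
        have := b.2
        rw [if_neg (by omega)]
        simp

/-- Sum of all entries of `S^k`. -/
noncomputable def entrySum (n k : ℕ) : ℂ := ∑ i, ∑ j, (shiftMatrix n ^ k) i j

theorem entrySum_ne_zero (n k : ℕ) (h : k < n) : entrySum n k ≠ 0 := by
  have : entrySum n k =
      (((Finset.univ : Finset (Fin n × Fin n)).filter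
        (fun x => (x.1 : ℕ) + k = x.2)).card : ℂ) := by
    rw [entrySum, ← Fintype.sum_prod_type' (fun i j => (shiftMatrix n ^ k) i j)]
    simp only [shift_pow_apply]
    simp
  rw [this]
  rw [Nat.cast_ne_zero, ← Nat.pos_iff_ne_zero, Finset.card_pos]
  exact ⟨(⟨0, by omega⟩, ⟨k, h⟩), by simp⟩

theorem shift_pow_zero (n k : ℕ) (h : n ≤ k) : shiftMatrix n ^ k = 0 := by
  ext i j
  rw [shift_pow_apply, if_neg (by omega)]
  rfl

theorem det_scalar_sub (n m : ℕ) (hm : 0 < m) (z : ℂ) :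
    (Matrix.scalar (Fin n) z - shiftMatrix n ^ m).det = z ^ n := by
  rw [Matrix.det_of_isUpperTriangular]
  · have : m ≠ 0 := by omega
    simp [shift_pow_apply, this]
  · intro i j hij
    have hij' : (j : ℕ) < i := hij
    have h1 : i ≠ j := by
      rintro rfl
      omega
    have h2 : ¬ ((i : ℕ) + m = j) := by omega
    simp [shift_pow_apply, h1, h2]

theorem eval_key (n m p : ℕ) (hm : 0 < m) (hp : n ≤ m * (p + 1)) (δ z : ℂ) (hz : z ≠ 0) :
    (Matrix.scalar (Fin n) z - (shiftMatrix n ^ m + δ • allOnes n)).det * z ^ (p + 1) =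
      z ^ n * (z ^ (p + 1) - δ * ∑ k ∈ Finset.range (p + 1), entrySum n (m * k) * z ^ (p - k)) := by
  set A := Matrix.scalar (Fin n) z - shiftMatrix n ^ m with hA
  have hdet : A.det = z ^ n := det_scalar_sub n m hm z
  set B := ∑ k ∈ Finset.range (p + 1),
    (shiftMatrix n ^ m) ^ k * (Matrix.scalar (Fin n) z) ^ (p - k) with hB
  have hcomm : Commute (shiftMatrix n ^ m) (Matrix.scalar (Fin n) z) :=
    (Matrix.scalar_commute z (fun r => mul_comm _ _) _).symm
  have hAB : A * B = z ^ (p + 1) • (1 : Matrix (Fin n) (Fin n) ℂ) := by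
    have := hcomm.mul_neg_geom_sum₂ (p + 1)
    rw [← pow_mul, shift_pow_zero n _ hp, sub_zero] at this
    simp only [Nat.add_sub_cancel] at this
    rw [hA, hB, this, ← map_pow, Matrix.scalar_apply, Matrix.smul_one_eq_diagonal]
  have hzp : z ^ (p + 1) ≠ 0 := pow_ne_zero _ hz
  have hinv : A⁻¹ = (z ^ (p + 1))⁻¹ • B := by
    apply Matrix.inv_eq_right_inv
    rw [Matrix.mul_smul, hAB, smul_smul, inv_mul_cancel₀ hzp, one_smul]
  have hBsum : ∑ i, ∑ j, B i j =
      ∑ k ∈ Finset.range (p + 1), entrySum n (m * k) * z ^ (p - k) := by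
    have : ∀ i j, B i j = ∑ k ∈ Finset.range (p + 1),
        (shiftMatrix n ^ (m * k)) i j * z ^ (p - k) := by
      intro i j
      rw [hB, Matrix.sum_apply]
      refine Finset.sum_congr rfl fun k _ => ?_
      rw [← pow_mul, ← map_pow, Matrix.scalar_apply, Matrix.mul_diagonal]
    simp only [this, entrySum, Finset.sum_mul]
    rw [Finset.sum_comm]
    conv_rhs => rw [Finset.sum_comm]
    rw [Finset.sum_comm]
    refine Finset.sum_congr rfl fun i _ => ?_
    rw [Finset.sum_comm]
  have hM : Matrix.scalar (Fin n) z - (shiftMatrix n ^ m + δ • allOnes n) =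
      A + Matrix.replicateCol Unit (fun _ : Fin n => -δ) *
        Matrix.replicateRow Unit (fun _ : Fin n => (1 : ℂ)) := by
    rw [← sub_sub, ← hA, sub_eq_add_neg]
    congr 1
    ext i j
    simp [allOnes, Matrix.mul_apply]
  have hu : IsUnit A.det := by
    rw [hdet]
    exact (pow_ne_zero _ hz).isUnit
  rw [hM, Matrix.det_add_replicateCol_mul_replicateRow hu, hdet, hinv, ← hBsum]
  have : ((1 : Matrix Unit Unit ℂ) +
      (Matrix.replicateRow Unit (fun _ : Fin n => (1 : ℂ)) * ((z ^ (p + 1))⁻¹ • B) :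
        Matrix Unit (Fin n) ℂ) *
      Matrix.replicateCol Unit (fun _ : Fin n => -δ)).det =
      1 - δ * ((z ^ (p + 1))⁻¹ * ∑ i, ∑ j, B i j) := by
    rw [Matrix.det_unique]
    simp only [Matrix.add_apply, Matrix.mul_apply, Matrix.replicateRow_apply,
      Matrix.replicateCol_apply, Matrix.smul_apply, smul_eq_mul, one_mul, Matrix.one_apply_eq]
    rw [Finset.sum_comm (f := fun i j => B i j), ← Finset.sum_mul]
    simp only [← Finset.mul_sum]
    ring
  rw [this]
  field_simp

theorem charpoly_eq (n m p : ℕ) (hm : 0 < m) (hp : n ≤ m * (p + 1)) (hpn : p + 1 ≤ n) (δ : ℂ) :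
    Matrix.charpoly (shiftMatrix n ^ m + δ • allOnes n) =
      X ^ (n - p - 1) * (X ^ (p + 1) - C δ * ∑ k ∈ Finset.range (p + 1),
        C (entrySum n (m * k)) * X ^ (p - k)) := by
  apply Polynomial.eq_of_infinite_eval_eq
  refine Set.Infinite.mono ?_ (Set.Finite.infinite_compl (Set.finite_singleton (0 : ℂ)))
  intro z hz
  have hz : z ≠ 0 := hz
  have h := eval_key n m p hm hp δ z hz
  have hzp : z ^ (p + 1) ≠ 0 := pow_ne_zero _ hz
  apply mul_right_cancel₀ hzp
  rw [Matrix.eval_charpoly, h]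
  simp only [eval_mul, eval_sub, eval_pow, eval_X, eval_C, eval_finsetSum]
  obtain ⟨r, rfl⟩ := Nat.exists_eq_add_of_le hpn
  have : p + 1 + r - p - 1 = r := by omega
  rw [this]
  ring

theorem not_diag (n m : ℕ) (hm : 2 ≤ m) (hmn : m + 2 ≤ n) (δ : ℂ) :
    ¬ ∃ (P : Matrix (Fin n) (Fin n) ℂ) (d : Fin n → ℂ), IsUnit P.det ∧
        shiftMatrix n ^ m + δ • allOnes n = P * Matrix.diagonal d * P⁻¹ := by
  rintro ⟨P, d, hP, h⟩
  set M := shiftMatrix n ^ m + δ • allOnes n with hM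
  -- the action of M on differences of basis vectors
  have key : ∀ a b : Fin n, ∀ i, (M.mulVec (Pi.single a 1 - Pi.single b 1)) i =
      (if (i : ℕ) + m = a then 1 else 0) - (if (i : ℕ) + m = b then 1 else 0) := by
    intro a b i
    rw [Matrix.mulVec_sub]
    simp [hM, allOnes, shift_pow_apply]
  let e0 : Fin n := ⟨0, by omega⟩
  let e1 : Fin n := ⟨1, by omega⟩
  let f0 : Fin n := ⟨m, by omega⟩
  let f1 : Fin n := ⟨m + 1, by omega⟩
  have h1 : M.mulVec (Pi.single f0 1 - Pi.single f1 1) = Pi.single e0 1 - Pi.single e1 1 := by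
    ext i
    rw [key]
    simp only [f0, f1, e0, e1, Pi.sub_apply, Pi.single_apply, Fin.ext_iff]
    congr 1
    · simp
    · congr 1
      simp only [eq_iff_iff]
      omega
  have h2 : M.mulVec (Pi.single e0 1 - Pi.single e1 1) = 0 := by
    ext i
    rw [key]
    simp only [e0, e1]
    rw [if_neg (by omega), if_neg (by omega)]
    simp
  set v : Fin n → ℂ := Pi.single f0 1 - Pi.single f1 1 with hv
  have hne : M.mulVec v ≠ 0 := by
    rw [h1]
    intro h0
    have := congrFun h0 e0
    simp [e0, e1, Pi.single_apply] at this
  apply hne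
  set y := (P⁻¹).mulVec v with hy
  have hPM : P⁻¹ * M = Matrix.diagonal d * P⁻¹ := by
    rw [h, Matrix.mul_assoc, Matrix.nonsing_inv_mul_cancel_left _ _ hP]
  have hMM : (Matrix.diagonal d).mulVec ((Matrix.diagonal d).mulVec y) = 0 := by
    have hstep : ∀ x, (Matrix.diagonal d).mulVec ((P⁻¹).mulVec x) = (P⁻¹).mulVec (M.mulVec x) := by
      intro x
      rw [Matrix.mulVec_mulVec, ← hPM, Matrix.mulVec_mulVec]
    rw [hy, hstep, hstep, h1, h2, Matrix.mulVec_zero]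
  have hD : (Matrix.diagonal d).mulVec y = 0 := by
    ext i
    have := congrFun hMM i
    simp only [Matrix.mulVec_diagonal, Pi.zero_apply] at this ⊢
    rcases mul_eq_zero.1 this with h' | h'
    · rw [h', zero_mul]
    · exact h'
  rw [h, Matrix.mul_assoc, ← Matrix.mulVec_mulVec, ← Matrix.mulVec_mulVec, ← hy, hD,
    Matrix.mulVec_zero]

/-- For `2 ≤ m ≤ n − 2` and `δ ≠ 0`, the algebraic multiplicity of the eigenvalue `0`
of `S^m + δJ` equals `n − ⌊(n−1)/m⌋ − 1`; since `m − 1 < n − ⌊(n−1)/m⌋ − 1`,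
the matrix `S^m + δJ` is not diagonalizable. -/
theorem stmt_14 (n m : ℕ) (hm : 2 ≤ m) (hmn : m ≤ n - 2) (hn : 4 ≤ n)
    (δ : ℂ) (hδ : δ ≠ 0) :
    (Matrix.charpoly (shiftMatrix n ^ m + δ • allOnes n)).rootMultiplicity 0 =
      n - (n - 1) / m - 1 ∧
    m - 1 < n - (n - 1) / m - 1 ∧
    ¬ ∃ (P : Matrix (Fin n) (Fin n) ℂ) (d : Fin n → ℂ), IsUnit P.det ∧
        shiftMatrix n ^ m + δ • allOnes n = P * Matrix.diagonal d * P⁻¹ := by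
  have hp1 : n ≤ m * ((n - 1) / m + 1) := by
    have := Nat.lt_mul_div_succ (n - 1) (show 0 < m by omega)
    omega
  have hp2 : m * ((n - 1) / m) ≤ n - 1 := Nat.mul_div_le _ _
  have hp3 : (n - 1) / m + m < n := by
    generalize (n - 1) / m = p at *
    rcases Nat.lt_or_ge p 2 with h | h
    · omega
    · nlinarith [Nat.sub_add_cancel (show 1 ≤ n by omega), Nat.mul_le_mul hm h,
        mul_le_mul_of_nonneg_left h (Nat.zero_le m),
        mul_add_mul_le_mul_add_mul hm h, hp2]
  refine ⟨?_, by omega, not_diag n m hm (by omega) δ⟩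
  generalize (n - 1) / m = p at *
  rw [charpoly_eq n m p (by omega) hp1 (by omega) δ]
  set q : ℂ[X] := X ^ (p + 1) - C δ * ∑ k ∈ Finset.range (p + 1),
        C (entrySum n (m * k)) * X ^ (p - k) with hq
  have hq0 : q.eval 0 ≠ 0 := by
    have : q.eval 0 = - (δ * entrySum n (m * p)) := by
      simp only [hq, eval_mul, eval_sub, eval_pow, eval_X, eval_C, eval_finsetSum]
      rw [Finset.sum_range_succ, Finset.sum_eq_zero]
      · simp
      · intro k hk
        have := Finset.mem_range.1 hk
        rw [zero_pow (by omega), mul_zero]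
    rw [this]
    exact neg_ne_zero.2 (mul_ne_zero hδ (entrySum_ne_zero _ _ (by omega)))
  have hqne : q ≠ 0 := by
    rintro h
    simp [h] at hq0
  rw [rootMultiplicity_mul (mul_ne_zero (pow_ne_zero _ X_ne_zero) hqne),
    rootMultiplicity_eq_zero (p := q) hq0, add_zero]
  have := rootMultiplicity_X_sub_C_pow (0 : ℂ) (n - p - 1)
  simpa using this
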